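/- Let G be a finite multigraph, t ≥ 1 an integer, and K a field of characteristic 0. The total dimension of B_G^{F_t} as a vector space over K equals the number of t-labeled forests of G. -/

import Mathlib

open MvPolynomial

namespace ForestAlg

variable {V E : Type*}

/-- Two vertices are directly connected by an edge of `A`. -/
def edgeRel (ends : E → Sym2 V) (A : Finset E) (v w : V) : Prop :=
  ∃ e ∈ A, ends e = s(v, w)

/-- Number of connected components of the spanning subgraph `(V, A)`. -/
noncomputable def numComponents (ends : E → Sym2 V) (A : Finset E) : ℕ :=
  Nat.card (Quot (edgeRel ends A))

/-- Rank `r(A) = v(G) - c(V,A)`. -/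
noncomputable def rank (ends : E → Sym2 V) (A : Finset E) : ℕ :=
  Nat.card V - numComponents ends A

/-- `A` is a subforest (contains no cycle): `|A| = v(G) - c(V,A)`. -/
def IsForest (ends : E → Sym2 V) (A : Finset E) : Prop :=
  A.card + numComponents ends A = Nat.card V

/-- The Tutte polynomial, evaluated at `(x, y)`. -/
noncomputable def tutte [Fintype E] {R : Type*} [CommRing R]
    (ends : E → Sym2 V) (x y : R) : R :=
  ∑ A ∈ (Finset.univ : Finset E).powerset,
    (x - 1) ^ (rank ends Finset.univ - rank ends A) *
      (y - 1) ^ (A.card - rank ends A)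

/-- `e ∉ F` is externally active for the subforest `F` with respect to the linear
order `o`: `F + e` contains a cycle and `e` is the minimal edge of that cycle
(the edges of the unique cycle of `F + e` are those whose removal does not
decrease the rank). -/
def ExtActive [DecidableEq E] (o : LinearOrder E) (ends : E → Sym2 V)
    (F : Finset E) (e : E) : Prop :=
  e ∉ F ∧ ¬ IsForest ends (insert e F) ∧
    ∀ f ∈ insert e F,
      rank ends ((insert e F).erase f) = rank ends (insert e F) → o.le e f

/-- External activity `act_G(F)`. -/
noncomputable def act [DecidableEq E] (o : LinearOrder E) (ends : E → Sym2 V)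
    (F : Finset E) : ℕ :=
  Set.ncard {e : E | ExtActive o ends F e}

/-- `D_I`: number of edges with one endpoint in `I` and the other outside `I`. -/
noncomputable def crossCount {n : ℕ} (ends : E → Sym2 (Fin n))
    (I : Finset (Fin n)) : ℕ :=
  Set.ncard {e : E | (∃ v ∈ ends e, v ∈ I) ∧ ∃ w ∈ ends e, w ∉ I}

/-- The ideal `J_G^{F_t}` generated by `(∑_{i ∈ I} x_i)^{t·D_I + 1}` over nonempty `I`. -/
noncomputable def forestIdeal (K : Type*) [Field K] {n : ℕ} (t : ℕ)
    (ends : E → Sym2 (Fin n)) : Ideal (MvPolynomial (Fin n) K) :=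
  Ideal.span {p | ∃ I : Finset (Fin n), I.Nonempty ∧
    p = (∑ i ∈ I, X i) ^ (t * crossCount ends I + 1)}

/-- The `k`-th graded component of `K[x_1,…,x_n]/J` (for homogeneous `J`):
the image of the degree-`k` homogeneous part in the quotient. -/
noncomputable def gradedPiece (K : Type*) [Field K] {n : ℕ}
    (J : Ideal (MvPolynomial (Fin n) K)) (k : ℕ) :
    Submodule K (MvPolynomial (Fin n) K ⧸ J) :=
  Submodule.map (Ideal.Quotient.mkₐ K J).toLinearMap
    (homogeneousSubmodule (Fin n) K k)

/-- Dimension of the `k`-th graded component of the quotient. -/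
noncomputable def gradedDim (K : Type*) [Field K] {n : ℕ}
    (J : Ideal (MvPolynomial (Fin n) K)) (k : ℕ) : ℕ :=
  Module.finrank K (gradedPiece K J k)


/-- A `t`-labeled forest of `G`: a subforest together with a label in `{1,…,t}`
on each of its edges (the labelling function is `0` off the forest). -/
def LabeledForest (ends : E → Sym2 V) (t : ℕ) : Type _ :=
  {Fl : Finset E × (E → ℕ) // IsForest ends Fl.1 ∧
    (∀ e ∈ Fl.1, 1 ≤ Fl.2 e ∧ Fl.2 e ≤ t) ∧ ∀ e ∉ Fl.1, Fl.2 e = 0}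

/-- The weight `ω(F)` of a `t`-labeled forest: the sum of the labels of its
edges. -/
def weight {t : ℕ} {ends : E → Sym2 V} (F : LabeledForest ends t) : ℕ :=
  ∑ e ∈ F.val.1, F.val.2 e

/-- The underlying subforest of a `t`-labeled forest. -/
def LabeledForest.edges {t : ℕ} {ends : E → Sym2 V} (F : LabeledForest ends t) :
    Finset E :=
  F.val.1

section LinearAlgebra

variable {K M : Type} [Field K] [AddCommGroup M] [Module K M]

theorem rank_quotient_le_add {δ ρ : M →ₗ[K] M} {U U' U'' : Submodule K M}
    (hδ : U' ≤ U.comap δ) (hρ : U'' ≤ U'.comap ρ)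
    (h : ∀ f, δ f ∈ U → ∃ a, f - ρ a ∈ U') :
    Module.rank K (M ⧸ U') ≤ Module.rank K (M ⧸ U) + Module.rank K (M ⧸ U'') := by
  rw [← LinearMap.rank_range_add_rank_ker (U'.mapQ U δ hδ)]
  refine add_le_add (Submodule.rank_le _) ?_
  refine le_trans (Submodule.rank_mono ?_) (rank_range_le (U''.mapQ U' ρ hρ))
  intro x hx
  obtain ⟨f, rfl⟩ := Submodule.mkQ_surjective U' x
  have hf : δ f ∈ U := by simpa using hx
  obtain ⟨a, ha⟩ := h f hf
  refine ⟨U''.mkQ a, ?_⟩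
  simp only [Submodule.mkQ_apply, Submodule.mapQ_apply]
  exact ((Submodule.Quotient.eq U').2 ha).symm

theorem add_rank_quotient_le {δ ρ : M →ₗ[K] M} {U U' U'' : Submodule K M}
    (hδ : U' ≤ U.comap δ) (hδs : Function.Surjective δ) (hδρ : ∀ a, δ (ρ a) = 0)
    (hρ : U'' = U'.comap ρ) :
    Module.rank K (M ⧸ U) + Module.rank K (M ⧸ U'') ≤ Module.rank K (M ⧸ U') := by
  have hs : Function.Surjective (U'.mapQ U δ hδ) := by
    intro x
    obtain ⟨f, rfl⟩ := Submodule.mkQ_surjective U x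
    obtain ⟨g, rfl⟩ := hδs f
    exact ⟨U'.mkQ g, by simp⟩
  rw [← LinearMap.rank_range_add_rank_ker (U'.mapQ U δ hδ), LinearMap.range_eq_top.2 hs,
    rank_top]
  refine add_le_add le_rfl ?_
  have hinj : Function.Injective (U''.mapQ U' ρ hρ.le) := by
    rw [← LinearMap.ker_eq_bot, Submodule.ker_mapQ, ← hρ, Submodule.mkQ_map_self]
  rw [← rank_range_of_injective _ hinj]
  refine Submodule.rank_mono ?_
  rintro _ ⟨x, rfl⟩
  obtain ⟨f, rfl⟩ := Submodule.mkQ_surjective U'' x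
  simp [hδρ]

end LinearAlgebra

section Derivations

variable {V : Type} [DecidableEq V] {K : Type} [Field K]

/-- The derivation `∂/∂x_i - ∂/∂x_j`. -/
noncomputable def diffDeriv (K : Type) [Field K] (i j : V) :
    Derivation K (MvPolynomial V K) (MvPolynomial V K) :=
  pderiv i - pderiv j

omit [DecidableEq V] in
theorem diffDeriv_apply (i j : V) (f : MvPolynomial V K) :
    diffDeriv K i j f = pderiv i f - pderiv j f := rfl

theorem diffDeriv_X (i j k : V) :
    diffDeriv K i j (X k) = C ((if k = i then 1 else 0) - if k = j then 1 else 0) := by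
  simp only [diffDeriv_apply, pderiv_X, Pi.single_apply]
  split_ifs <;> simp

/-- Merging the vertex `j` into `i`. -/
def merge (i j : V) : V → V := Function.update id j i

theorem merge_left (i j : V) : merge i j i = i := by
  by_cases h : i = j <;> simp [merge, Function.update_apply]

theorem merge_right (i j : V) : merge i j j = i := by simp [merge]

theorem merge_of_ne {i j k : V} (h : k ≠ j) : merge i j k = k := by simp [merge, h]

theorem merge_ne {i j : V} (h : i ≠ j) (k : V) : merge i j k ≠ j := by
  by_cases hk : k = j
  · rw [hk, merge_right]; exact h
  · rwa [merge_of_ne hk]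

variable [Fintype V]

/-- The substitution `x_m ↦ ∑_{c k = m} x_k` dual to the vertex map `c`. -/
noncomputable def pullback (K : Type) [Field K] (c : V → V) :
    MvPolynomial V K →ₐ[K] MvPolynomial V K :=
  aeval fun m => ∑ k with c k = m, X k

theorem pderiv_pullback (c : V → V) (k : V) (f : MvPolynomial V K) :
    pderiv k (pullback K c f) = pullback K c (pderiv (c k) f) := by
  induction f using MvPolynomial.induction_on with
  | C a => simp [pullback]
  | add p q hp hq => simp [hp, hq]
  | mul_X p m hp =>
    have hX : pderiv k (pullback K c (X m)) = pullback K c (pderiv (c k) (X m)) := by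
      simp only [pullback, aeval_X, map_sum, pderiv_X, Pi.single_apply]
      rw [Finset.sum_ite_eq' ]
      simp only [Finset.mem_filter, Finset.mem_univ, true_and, eq_comm (a := m)]
      split_ifs <;> simp
    simp only [map_mul, Derivation.leibniz, hX, hp, smul_eq_mul, map_add]

theorem diffDeriv_pullback (c : V → V) (i j : V) (f : MvPolynomial V K) :
    diffDeriv K i j (pullback K c f) = pullback K c (diffDeriv K (c i) (c j) f) := by
  simp [diffDeriv_apply, pderiv_pullback]

theorem diffDeriv_pullback_merge (i j : V) (f : MvPolynomial V K) :
    diffDeriv K i j (pullback K (merge i j) f) = 0 := by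
  rw [diffDeriv_pullback, merge_left, merge_right, diffDeriv_apply, sub_self, map_zero]

theorem constantCoeff_pullback (c : V → V) (f : MvPolynomial V K) :
    constantCoeff (pullback K c f) = constantCoeff f := by
  induction f using MvPolynomial.induction_on with
  | C a => simp [pullback]
  | add p q hp hq => simp [hp, hq]
  | mul_X p m hp => simp [pullback]

theorem pullback_sum_X (c : V → V) (I : Finset V) :
    pullback K c (∑ i ∈ I, X i) = ∑ k with c k ∈ I, X k := by
  simp only [pullback, map_sum, aeval_X]
  rw [Finset.sum_comm' (t' := Finset.univ.filter fun k => c k ∈ I) (s' := fun k => {c k})]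
  · simp
  · intro x y
    simp only [Finset.mem_filter, Finset.mem_univ, true_and, Finset.mem_singleton]
    constructor
    · rintro ⟨h, rfl⟩; exact ⟨rfl, h⟩
    · rintro ⟨rfl, h⟩; exact ⟨h, rfl⟩

variable [CharZero K]

/-- The kernel of `∂/∂x_i - ∂/∂x_j` consists of the polynomials in `x_i + x_j` and the other
variables. -/
theorem pullback_merge_eq_self {i j : V} (hij : i ≠ j) {f : MvPolynomial V K}
    (hf : diffDeriv K i j f = 0) : pullback K (merge i j) f = f := by
  let u : V → Polynomial (MvPolynomial V K) := fun k =>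
    Polynomial.C (X k) + Polynomial.C (diffDeriv K i j (X k)) * Polynomial.X
  let τ : MvPolynomial V K →ₐ[K] Polynomial (MvPolynomial V K) := aeval u
  have hτ : ∀ g, Polynomial.derivative (τ g) = τ (diffDeriv K i j g) := by
    intro g
    induction g using MvPolynomial.induction_on with
    | C a =>
      have : (C a : MvPolynomial V K) = algebraMap K _ a := rfl
      rw [this, AlgHom.commutes, Derivation.map_algebraMap, map_zero,
        IsScalarTower.algebraMap_apply K (MvPolynomial V K)]
      exact Polynomial.derivative_C
    | add p q hp hq => simp [hp, hq]
    | mul_X p m hp =>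
      have hX : Polynomial.derivative (τ (X m)) = τ (diffDeriv K i j (X m)) := by
        simp only [τ, u, aeval_X, diffDeriv_X, Polynomial.derivative_add, Polynomial.derivative_C,
          Polynomial.derivative_C_mul, Polynomial.derivative_X, zero_add, mul_one]
        rw [aeval_C, IsScalarTower.algebraMap_apply K (MvPolynomial V K)]
        rfl
      simp only [map_mul, Derivation.leibniz, Polynomial.derivative_mul, hX, hp, smul_eq_mul,
        map_add]
      ring
  have hconst : (τ f).natDegree = 0 :=
    Polynomial.derivative_eq_zero.1 (by rw [hτ, hf, map_zero])
  have heval : ∀ a : MvPolynomial V K, ∀ g : MvPolynomial V K, Polynomial.eval a (τ g)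
      = aeval (fun k => X k + diffDeriv K i j (X k) * a) g := by
    intro a g
    induction g using MvPolynomial.induction_on with
    | C b =>
      rw [aeval_C]
      simp only [aeval_C]
      rw [IsScalarTower.algebraMap_apply K (MvPolynomial V K)]
      exact Polynomial.eval_C
    | add p q hp hq => simp [hp, hq]
    | mul_X p m hp => simp [hp, τ, u]
  have h0 : Polynomial.eval 0 (τ f) = f := by
    rw [heval]; simp
  have h1 : Polynomial.eval (X j) (τ f) = pullback K (merge i j) f := by
    rw [heval, pullback]
    congr 2
    funext k
    rw [diffDeriv_X]
    by_cases hkj : k = j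
    · subst hkj
      rw [Finset.filter_false_of_mem fun m _ => merge_ne hij m]
      simp [hij.symm]
    · by_cases hki : k = i
      · subst hki
        have : (Finset.univ.filter fun m => merge k j m = k) = {k, j} := by
          ext m
          by_cases hm : m = j
          · simp [hm, merge_right]
          · simp [hm, merge_of_ne]
        rw [this, Finset.sum_pair hij]
        simp [hij]
      · have : (Finset.univ.filter fun m => merge i j m = k) = {k} := by
          ext m
          by_cases hm : m = j
          · simp [hm, merge_right, Ne.symm hki, Ne.symm hkj]
          · simp [hm, merge_of_ne]
        rw [this]
        simp [hki, hkj]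
  rw [← h1]
  conv_rhs => rw [← h0]
  rw [Polynomial.eq_C_of_natDegree_eq_zero hconst, Polynomial.eval_C, Polynomial.eval_C]

theorem span_pullback_mul_pow {i j : V} (hij : i ≠ j) {s : MvPolynomial V K} {ε : K}
    (hε : ε ≠ 0) (hs : diffDeriv K i j s = C ε) :
    Submodule.span K {f | ∃ a k, f = pullback K (merge i j) a * s ^ k} = ⊤ := by
  rw [eq_top_iff]
  rintro f -
  induction f using MvPolynomial.induction_on with
  | C a => exact Submodule.subset_span ⟨C a, 0, by simp [pullback]⟩
  | add p q hp hq => exact add_mem hp hq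
  | mul_X p m hp =>
    obtain ⟨a', e, hX⟩ : ∃ a' e, X m = pullback K (merge i j) a' + C e * s := by
      refine ⟨X m - C (((if m = i then 1 else 0) - if m = j then 1 else 0) * ε⁻¹) * s,
        ((if m = i then 1 else 0) - if m = j then 1 else 0) * ε⁻¹, ?_⟩
      rw [pullback_merge_eq_self hij]
      · ring
      · rw [map_sub, diffDeriv_X, ← smul_eq_C_mul, Derivation.map_smul, hs, smul_eq_C_mul,
          ← C_mul, mul_assoc, inv_mul_cancel₀ hε, mul_one, sub_self]
    induction hp using Submodule.span_induction with
    | mem x hx =>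
      obtain ⟨a, k, rfl⟩ := hx
      have : pullback K (merge i j) a * s ^ k * X m =
          pullback K (merge i j) (a * a') * s ^ k +
            e • (pullback K (merge i j) a * s ^ (k + 1)) := by
        rw [hX, smul_eq_C_mul, map_mul]; ring
      rw [this]
      exact add_mem (Submodule.subset_span ⟨_, _, rfl⟩)
        (Submodule.smul_mem _ _ (Submodule.subset_span ⟨_, _, rfl⟩))
    | zero => simp
    | add x y _ _ hx hy => rw [add_mul]; exact add_mem hx hy
    | smul c x _ hx => rw [smul_mul_assoc]; exact Submodule.smul_mem _ _ hx

theorem exists_antiderivative {i j : V} (hij : i ≠ j) {s : MvPolynomial V K} {ε : K}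
    (hε : ε ≠ 0) (hs : diffDeriv K i j s = C ε) (m : ℕ) (f : MvPolynomial V K) :
    ∃ h, diffDeriv K i j (h * s ^ (m + 1)) = f * s ^ m := by
  have hf : f ∈ Submodule.span K {f | ∃ a k, f = pullback K (merge i j) a * s ^ k} := by
    rw [span_pullback_mul_pow hij hε hs]; trivial
  induction hf using Submodule.span_induction with
  | mem x hx =>
    obtain ⟨a, k, rfl⟩ := hx
    have hne : ((k + m + 1 : ℕ) : K) * ε ≠ 0 := mul_ne_zero (Nat.cast_ne_zero.2 (by omega)) hε
    refine ⟨(((k + m + 1 : ℕ) : K) * ε)⁻¹ • (pullback K (merge i j) a * s ^ k), ?_⟩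
    rw [smul_mul_assoc, Derivation.map_smul, mul_assoc, ← pow_add, Derivation.leibniz,
      diffDeriv_pullback_merge, Derivation.leibniz_pow, hs, smul_zero, add_zero,
      inv_smul_eq_iff₀ hne, smul_eq_C_mul, C_mul, C_eq_coe_nat]
    simp only [smul_eq_mul, nsmul_eq_mul, ← add_assoc, Nat.add_sub_cancel]
    ring
  | zero => exact ⟨0, by simp⟩
  | add x y _ _ hx hy =>
    obtain ⟨a, ha⟩ := hx
    obtain ⟨b, hb⟩ := hy
    exact ⟨a + b, by rw [add_mul, map_add, ha, hb, add_mul]⟩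
  | smul c x _ hx =>
    obtain ⟨a, ha⟩ := hx
    exact ⟨c • a, by rw [smul_mul_assoc, Derivation.map_smul, ha, smul_mul_assoc]⟩

theorem diffDeriv_surjective {i j : V} (hij : i ≠ j) :
    Function.Surjective (diffDeriv K i j) := by
  intro f
  obtain ⟨h, hh⟩ := exists_antiderivative (K := K) hij one_ne_zero (s := X i)
    (by rw [diffDeriv_X]; simp [hij]) 0 f
  exact ⟨_, by rw [hh]; simp⟩

end Derivations

section Ideals

variable {V : Type} [DecidableEq V] {K : Type} [Field K]

/-- The number of edges of the edge list `l` with exactly one endpoint in `I`. -/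
def crossNum (l : List (V × V)) (I : Finset V) : ℕ :=
  l.countP fun p => decide ¬(p.1 ∈ I ↔ p.2 ∈ I)

/-- The ideal generated by the powers `(∑_{i ∈ I} x_i) ^ (D_I + 1)` for an edge list. -/
noncomputable def cutIdeal (K : Type) [Field K] (l : List (V × V)) :
    Ideal (MvPolynomial V K) :=
  Ideal.span {p | ∃ I : Finset V, p = (∑ i ∈ I, X i) ^ (crossNum l I + 1)}

/-- The polynomials killed at the origin by all products of `∂/∂x_i - ∂/∂x_j` over sublists
of the edge list. -/
noncomputable def inverseSystem (K : Type) [Field K] :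
    List (V × V) → Submodule K (MvPolynomial V K)
  | [] => LinearMap.ker (lcoeff K (0 : V →₀ ℕ))
  | p :: l => inverseSystem K l ⊓ (inverseSystem K l).comap (diffDeriv K p.1 p.2).toLinearMap

/-- The edge list with the vertex `j` merged into `i`. -/
def mergeList (i j : V) (l : List (V × V)) : List (V × V) :=
  l.map (Prod.map (merge i j) (merge i j))

/-- The number of forests of an edge list, by deletion and contraction. -/
def forestCount : List (V × V) → ℕ
  | [] => 1
  | p :: l => if p.1 = p.2 then forestCount l
      else forestCount l + forestCount (mergeList p.1 p.2 l)
termination_by l => l.length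
decreasing_by all_goals simp [mergeList]

theorem forestCount_nil : forestCount ([] : List (V × V)) = 1 := by
  rw [forestCount]

theorem forestCount_cons_loop (i : V) (l : List (V × V)) :
    forestCount ((i, i) :: l) = forestCount l := by
  rw [forestCount, if_pos rfl]

theorem forestCount_cons {i j : V} (hij : i ≠ j) (l : List (V × V)) :
    forestCount ((i, j) :: l) = forestCount l + forestCount (mergeList i j l) := by
  rw [forestCount, if_neg hij]

theorem deletion_contraction_induction {P : List (V × V) → Prop} (nil : P [])
    (loop : ∀ i l, P l → P ((i, i) :: l))
    (cons : ∀ i j l, i ≠ j → P l → P (mergeList i j l) → P ((i, j) :: l)) (l : List (V × V)) :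
    P l := by
  induction hn : l.length using Nat.strong_induction_on generalizing l with
  | _ n ih =>
    subst hn
    match l with
    | [] => exact nil
    | (i, j) :: l =>
      by_cases hij : i = j
      · subst hij
        exact loop i l (ih _ (by simp) l rfl)
      · exact cons i j l hij (ih _ (by simp) l rfl) (ih _ (by simp [mergeList]) _ rfl)

theorem crossNum_cons (i j : V) (l : List (V × V)) (I : Finset V) :
    crossNum ((i, j) :: l) I = crossNum l I + if (i ∈ I ↔ j ∈ I) then 0 else 1 := by
  simp only [crossNum, List.countP_cons]
  split_ifs <;> simp_all

theorem diffDeriv_sum_X (i j : V) (I : Finset V) :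
    diffDeriv K i j (∑ k ∈ I, X k) = C ((if i ∈ I then 1 else 0) - if j ∈ I then 1 else 0) := by
  simp only [map_sum, diffDeriv_X]
  rw [← map_sum, Finset.sum_sub_distrib]
  simp

theorem pow_mem_cutIdeal (l : List (V × V)) (I : Finset V) {m : ℕ} (hm : crossNum l I + 1 ≤ m) :
    (∑ i ∈ I, X i) ^ m ∈ cutIdeal K l := by
  rw [← Nat.sub_add_cancel hm, pow_add]
  exact Ideal.mul_mem_left _ _ (Ideal.subset_span ⟨I, rfl⟩)

theorem diffDeriv_mem_cutIdeal {i j : V} {l : List (V × V)} {f : MvPolynomial V K}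
    (hf : f ∈ cutIdeal K ((i, j) :: l)) :
    f ∈ cutIdeal K l ∧ diffDeriv K i j f ∈ cutIdeal K l := by
  induction hf using Submodule.span_induction with
  | mem x hx =>
    obtain ⟨I, rfl⟩ := hx
    refine ⟨pow_mem_cutIdeal _ _ (by rw [crossNum_cons]; omega), ?_⟩
    rw [Derivation.leibniz_pow, diffDeriv_sum_X, crossNum_cons]
    by_cases h : i ∈ I ↔ j ∈ I
    · simp [h]
    · simp only [h, if_false, Nat.add_sub_cancel, smul_eq_mul, nsmul_eq_mul]
      exact Ideal.mul_mem_left _ _ (Ideal.mul_mem_right _ _ (pow_mem_cutIdeal _ _ le_rfl))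
  | zero => simp
  | add x y _ _ hx hy => exact ⟨add_mem hx.1 hy.1, by rw [map_add]; exact add_mem hx.2 hy.2⟩
  | smul a x _ hx =>
    refine ⟨Ideal.mul_mem_left _ _ hx.1, ?_⟩
    rw [smul_eq_mul, Derivation.leibniz, smul_eq_mul, smul_eq_mul]
    exact add_mem (Ideal.mul_mem_left _ _ hx.2) (Ideal.mul_mem_right _ _ hx.1)

theorem cutIdeal_le_inverseSystem (l : List (V × V)) :
    (cutIdeal K l).restrictScalars K ≤ inverseSystem K l := by
  induction l with
  | nil =>
    intro f hf
    change constantCoeff f = 0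
    have hle : cutIdeal K ([] : List (V × V)) ≤ RingHom.ker (constantCoeff (R := K) (σ := V)) := by
      rw [cutIdeal, Ideal.span_le]
      rintro _ ⟨I, rfl⟩
      simp [crossNum]
    exact hle hf
  | cons p l ih =>
    intro f hf
    exact ⟨ih (diffDeriv_mem_cutIdeal (i := p.1) (j := p.2) hf).1,
      ih (diffDeriv_mem_cutIdeal (i := p.1) (j := p.2) hf).2⟩

theorem cutIdeal_cons_loop (i : V) (l : List (V × V)) :
    cutIdeal K ((i, i) :: l) = cutIdeal K l := by
  simp [cutIdeal, crossNum_cons]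

omit [DecidableEq V] in
theorem inverseSystem_cons_loop (i : V) (l : List (V × V)) :
    inverseSystem K ((i, i) :: l) = inverseSystem K l := by
  rw [inverseSystem, inf_eq_left]
  intro f _
  simp [diffDeriv_apply]

variable [Fintype V]

theorem inverseSystem_map (c : V → V) (l : List (V × V)) :
    inverseSystem K (l.map (Prod.map c c)) =
      (inverseSystem K l).comap (pullback K c).toLinearMap := by
  induction l with
  | nil =>
    ext f
    change constantCoeff f = 0 ↔ constantCoeff (pullback K c f) = 0
    rw [constantCoeff_pullback]
  | cons p l ih =>
    ext f
    rw [List.map_cons, inverseSystem, inverseSystem, ih]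
    simp [diffDeriv_pullback]

theorem crossNum_mergeList (i j : V) (l : List (V × V)) (I : Finset V) :
    crossNum (mergeList i j l) I =
      crossNum ((i, j) :: l) (Finset.univ.filter fun k => merge i j k ∈ I) := by
  rw [crossNum_cons, crossNum, crossNum, mergeList, List.countP_map]
  simp only [Finset.mem_filter, Finset.mem_univ, true_and, merge_left, merge_right, if_true,
    add_zero]
  rfl

theorem cutIdeal_mergeList_le (i j : V) (l : List (V × V)) :
    (cutIdeal K (mergeList i j l)).restrictScalars K ≤
      ((cutIdeal K ((i, j) :: l)).restrictScalars K).comap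
        (pullback K (merge i j)).toLinearMap := by
  have hle : cutIdeal K (mergeList i j l) ≤
      (cutIdeal K ((i, j) :: l)).comap (pullback K (merge i j)) := by
    rw [cutIdeal, Ideal.span_le]
    rintro _ ⟨I, rfl⟩
    rw [SetLike.mem_coe, Ideal.mem_comap, map_pow, pullback_sum_X, crossNum_mergeList]
    exact pow_mem_cutIdeal _ _ le_rfl
  exact fun f hf => hle hf

omit [Fintype V] in
theorem rank_quotient_cutIdeal_nil_le :
    Module.rank K (MvPolynomial V K ⧸ cutIdeal K ([] : List (V × V))) ≤ 1 := by
  rw [rank_le_one_iff]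
  refine ⟨Ideal.Quotient.mk _ 1, fun v => ?_⟩
  obtain ⟨f, rfl⟩ := Ideal.Quotient.mk_surjective v
  refine ⟨constantCoeff f, ?_⟩
  have hX : ∀ i : V, (X i : MvPolynomial V K) ∈ cutIdeal K ([] : List (V × V)) := fun i => by
    simpa using pow_mem_cutIdeal (K := K) ([] : List (V × V)) {i} (m := 1) (by simp [crossNum])
  change Ideal.Quotient.mk _ (constantCoeff f • (1 : MvPolynomial V K)) = _
  rw [Ideal.Quotient.eq]
  induction f using MvPolynomial.induction_on with
  | C a => simp [smul_eq_C_mul]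
  | add p q hp hq =>
    rw [map_add, add_smul, add_sub_add_comm]
    exact add_mem hp hq
  | mul_X p m hp =>
    simpa using Ideal.mul_mem_left _ p (hX m)

variable [CharZero K]

theorem exists_mem_cutIdeal_diffDeriv_eq {i j : V} (hij : i ≠ j) {l : List (V × V)}
    {g : MvPolynomial V K} (hg : g ∈ cutIdeal K l) :
    ∃ h ∈ cutIdeal K ((i, j) :: l), diffDeriv K i j h = g := by
  suffices H : ∀ f, ∃ h ∈ cutIdeal K ((i, j) :: l), diffDeriv K i j h = f * g by
    simpa using H 1
  induction hg using Submodule.span_induction with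
  | mem x hx =>
    obtain ⟨I, rfl⟩ := hx
    intro f
    by_cases h : i ∈ I ↔ j ∈ I
    · obtain ⟨f, rfl⟩ := diffDeriv_surjective (K := K) hij f
      refine ⟨f * (∑ k ∈ I, X k) ^ (crossNum l I + 1), Ideal.mul_mem_left _ _
        (pow_mem_cutIdeal _ _ (by simp [crossNum_cons, h])), ?_⟩
      rw [Derivation.leibniz, Derivation.leibniz_pow, diffDeriv_sum_X]
      simp [h, mul_comm]
    · obtain ⟨a, ha⟩ := exists_antiderivative (K := K) hij (s := ∑ k ∈ I, X k)
        (ε := (if i ∈ I then 1 else 0) - if j ∈ I then 1 else 0)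
        (by by_cases hi : i ∈ I <;> by_cases hj : j ∈ I <;> simp_all)
        (diffDeriv_sum_X i j I) (crossNum l I + 1) f
      exact ⟨_, Ideal.mul_mem_left _ _ (pow_mem_cutIdeal _ _ (by simp [crossNum_cons, h])), ha⟩
  | zero => exact fun f => ⟨0, by simp⟩
  | add x y _ _ hx hy =>
    intro f
    obtain ⟨a, ha, ha'⟩ := hx f
    obtain ⟨b, hb, hb'⟩ := hy f
    exact ⟨a + b, add_mem ha hb, by rw [map_add, ha', hb', mul_add]⟩
  | smul r x _ hx =>
    intro f
    obtain ⟨a, ha, ha'⟩ := hx (f * r)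
    exact ⟨a, ha, by rw [ha', smul_eq_mul, mul_assoc]⟩

theorem rank_quotient_cutIdeal_le (l : List (V × V)) :
    Module.rank K (MvPolynomial V K ⧸ (cutIdeal K l).restrictScalars K) ≤ forestCount l := by
  induction l using deletion_contraction_induction with
  | nil =>
    rw [forestCount_nil, Nat.cast_one]
    exact rank_quotient_cutIdeal_nil_le
  | loop i l ih => rwa [cutIdeal_cons_loop, forestCount_cons_loop]
  | cons i j l hij ih₁ ih₂ =>
    rw [forestCount_cons hij, Nat.cast_add]
    refine le_trans (rank_quotient_le_add (δ := (diffDeriv K i j).toLinearMap)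
      (U := (cutIdeal K l).restrictScalars K) (fun f hf => (diffDeriv_mem_cutIdeal hf).2)
      (cutIdeal_mergeList_le i j l) ?_)
      (add_le_add ih₁ ih₂)
    intro f hf
    obtain ⟨h, hh, hh'⟩ := exists_mem_cutIdeal_diffDeriv_eq hij
      (show diffDeriv K i j f ∈ cutIdeal K l from hf)
    refine ⟨f - h, ?_⟩
    have : pullback K (merge i j) (f - h) = f - h :=
      pullback_merge_eq_self hij (by rw [map_sub, hh', sub_self])
    rw [AlgHom.toLinearMap_apply, this, sub_sub_cancel]
    exact hh

theorem le_rank_quotient_inverseSystem (l : List (V × V)) :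
    (forestCount l : Cardinal) ≤ Module.rank K (MvPolynomial V K ⧸ inverseSystem K l) := by
  induction l using deletion_contraction_induction with
  | nil =>
    have hs : Function.Surjective (lcoeff K (0 : V →₀ ℕ)) := fun a => ⟨C a, by simp [lcoeff]⟩
    rw [forestCount_nil, Nat.cast_one, inverseSystem,
      ((lcoeff K (0 : V →₀ ℕ)).quotKerEquivOfSurjective hs).rank_eq, Module.rank_self]
  | loop i l ih => rwa [inverseSystem_cons_loop, forestCount_cons_loop]
  | cons i j l hij ih₁ ih₂ =>
    rw [forestCount_cons hij, Nat.cast_add]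
    refine (add_le_add ih₁ ih₂).trans (add_rank_quotient_le
      (δ := (diffDeriv K i j).toLinearMap) (ρ := (pullback K (merge i j)).toLinearMap)
      inf_le_right (diffDeriv_surjective hij) (diffDeriv_pullback_merge i j) ?_)
    rw [mergeList, inverseSystem_map]
    ext f
    simp [inverseSystem, diffDeriv_pullback_merge]

theorem finrank_quotient_cutIdeal (l : List (V × V)) :
    Module.finrank K (MvPolynomial V K ⧸ cutIdeal K l) = forestCount l := by
  refine Module.finrank_eq_of_rank_eq (le_antisymm (rank_quotient_cutIdeal_le l) ?_)
  refine (le_rank_quotient_inverseSystem (K := K) l).trans ?_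
  exact LinearMap.rank_le_of_surjective _
    (Submodule.factor_surjective (cutIdeal_le_inverseSystem (K := K) l))

end Ideals

section Counting

variable {V E : Type} [DecidableEq V]

theorem forestCount_replicate_loop (i : V) (t : ℕ) (l : List (V × V)) :
    forestCount (List.replicate t (i, i) ++ l) = forestCount l := by
  induction t with
  | zero => simp
  | succ t ih => rw [List.replicate_succ, List.cons_append, forestCount_cons_loop, ih]

theorem forestCount_replicate {i j : V} (hij : i ≠ j) (t : ℕ) (l : List (V × V)) :
    forestCount (List.replicate t (i, j) ++ l) =
      forestCount l + t * forestCount (mergeList i j l) := by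
  induction t with
  | zero => simp
  | succ t ih =>
    have hmerge : mergeList i j (List.replicate t (i, j) ++ l) =
        List.replicate t (i, i) ++ mergeList i j l := by
      simp [mergeList, merge_left, merge_right]
    rw [List.replicate_succ, List.cons_append, forestCount_cons hij, ih, hmerge,
      forestCount_replicate_loop]
    ring

theorem mergeList_flatMap_replicate (i j : V) (t : ℕ) (pair : E → V × V) (es : List E) :
    mergeList i j (es.flatMap fun e => List.replicate t (pair e)) =
      es.flatMap fun e => List.replicate t (Prod.map (merge i j) (merge i j) (pair e)) := by
  simp [mergeList, List.map_flatMap]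

variable [DecidableEq E]

omit [DecidableEq V] in
theorem numComponents_insert_loop {ends : E → Sym2 V} {e : E} {i : V} (he : ends e = s(i, i))
    (F : Finset E) : numComponents ends (insert e F) = numComponents ends F := by
  refine Nat.card_congr
    ⟨Quot.lift (Quot.mk _) ?_, Quot.map id ?_, ?_, ?_⟩
  · rintro v w ⟨g, hg, hvw⟩
    rcases Finset.mem_insert.1 hg with rfl | hg
    · rw [he, Sym2.eq_iff] at hvw
      rcases hvw with ⟨rfl, rfl⟩ | ⟨rfl, rfl⟩ <;> rfl
    · exact Quot.sound ⟨g, hg, hvw⟩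
  · rintro v w ⟨g, hg, hvw⟩
    exact ⟨g, Finset.mem_insert_of_mem hg, hvw⟩
  · rintro ⟨v⟩; rfl
  · rintro ⟨v⟩; rfl

theorem numComponents_merge [Finite V] {ends : E → Sym2 V} {e : E} {i j : V} (hij : i ≠ j)
    (he : ends e = s(i, j)) (F : Finset E) :
    numComponents (fun g => (ends g).map (merge i j)) F =
      numComponents ends (insert e F) + 1 := by
  have hmk : ∀ v, (Quot.mk (edgeRel ends (insert e F)) (merge i j v)) = Quot.mk _ v := by
    intro v
    by_cases hv : v = j
    · subst hv
      rw [merge_right]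
      exact Quot.sound ⟨e, Finset.mem_insert_self _ _, he⟩
    · rw [merge_of_ne hv]
  rw [numComponents, numComponents, ← Finite.card_option]
  refine Nat.card_congr
    ⟨Quot.lift (fun v => if v = j then none else some (Quot.mk _ v)) ?_,
      fun o => o.elim (Quot.mk _ j) (Quot.lift (fun v => Quot.mk _ (merge i j v)) ?_), ?_, ?_⟩
  · rintro v w ⟨g, hg, hvw⟩
    obtain ⟨a, b, hab⟩ : ∃ a b, ends g = s(a, b) := by
      induction ends g with | _ a b => exact ⟨a, b, rfl⟩
    have hsound : (Quot.mk (edgeRel ends (insert e F)) (merge i j a)) =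
        Quot.mk _ (merge i j b) := by
      rw [hmk, hmk]
      exact Quot.sound ⟨g, Finset.mem_insert_of_mem hg, hab⟩
    dsimp only at hvw
    rw [hab, Sym2.map_mk, Sym2.eq_iff] at hvw
    rcases hvw with ⟨rfl, rfl⟩ | ⟨rfl, rfl⟩
    · rw [if_neg (merge_ne hij _), if_neg (merge_ne hij _), hsound]
    · rw [if_neg (merge_ne hij _), if_neg (merge_ne hij _), hsound]
  · rintro v w ⟨g, hg, hvw⟩
    rcases Finset.mem_insert.1 hg with rfl | hg
    · rw [he, Sym2.eq_iff] at hvw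
      rcases hvw with ⟨rfl, rfl⟩ | ⟨rfl, rfl⟩ <;> rw [merge_left, merge_right]
    · exact Quot.sound ⟨g, hg, by dsimp only; rw [hvw, Sym2.map_mk]⟩
  · rintro ⟨v⟩
    by_cases hv : v = j
    · simp [hv]
    · simp [hv, merge_of_ne hv]
  · rintro (_ | ⟨⟨v⟩⟩)
    · simp
    · simp [merge_ne hij, hmk]

theorem card_le_card_add_numComponents [Finite V] (ends : E → Sym2 V) (F : Finset E) :
    Nat.card V ≤ F.card + numComponents ends F := by
  induction F using Finset.induction_on generalizing ends with
  | empty =>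
    rw [Finset.card_empty, zero_add, numComponents]
    refine Nat.card_le_card_of_injective (Quot.mk _) fun v w h => ?_
    refine Quot.lift_mk (r := edgeRel ends ∅) id ?_ v |>.symm.trans
      ((congrArg _ h).trans (Quot.lift_mk (r := edgeRel ends ∅) id ?_ w))
    all_goals
      rintro a b ⟨g, hg, -⟩
      simp at hg
  | insert e F he ih =>
    rw [Finset.card_insert_of_notMem he]
    obtain ⟨i, j, hab⟩ : ∃ a b, ends e = s(a, b) := by
      induction ends e with | _ a b => exact ⟨a, b, rfl⟩
    by_cases hij : i = j
    · subst hij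
      rw [numComponents_insert_loop hab]
      have := ih ends
      omega
    · have := ih fun g => (ends g).map (merge i j)
      rw [numComponents_merge hij hab] at this
      omega

theorem not_isForest_insert_loop [Finite V] {ends : E → Sym2 V} {e : E} {i : V}
    (he : ends e = s(i, i)) {F : Finset E} (hF : e ∉ F) : ¬ IsForest ends (insert e F) := by
  rw [IsForest, Finset.card_insert_of_notMem hF, numComponents_insert_loop he]
  have := card_le_card_add_numComponents ends F
  omega

theorem isForest_insert_iff [Finite V] {ends : E → Sym2 V} {e : E} {i j : V} (hij : i ≠ j)
    (he : ends e = s(i, j)) {F : Finset E} (hF : e ∉ F) :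
    IsForest ends (insert e F) ↔ IsForest (fun g => (ends g).map (merge i j)) F := by
  rw [IsForest, IsForest, numComponents_merge hij he, Finset.card_insert_of_notMem hF]
  omega

omit [DecidableEq V] [DecidableEq E] in
theorem isForest_empty (ends : E → Sym2 V) [Finite V] : IsForest ends ∅ := by
  rw [IsForest, Finset.card_empty, zero_add, numComponents]
  refine (Nat.card_congr ⟨Quot.mk _, Quot.lift id ?_, fun v => rfl, ?_⟩).symm
  · rintro a b ⟨g, hg, -⟩
    simp at hg
  · rintro ⟨v⟩
    rfl

open Classical in
theorem forestCount_flatMap_replicate [Finite V] (t : ℕ) (pair : E → V × V) (es : List E)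
    (hes : es.Nodup) :
    forestCount (es.flatMap fun e => List.replicate t (pair e)) =
      ∑ F ∈ es.toFinset.powerset,
        if IsForest (fun e => Sym2.mk (pair e).1 (pair e).2) F then t ^ F.card else 0 := by
  induction es generalizing pair with
  | nil => simp [forestCount_nil, isForest_empty]
  | cons e es ih =>
    obtain ⟨he, hes⟩ := List.nodup_cons.1 hes
    have he' : e ∉ es.toFinset := by simpa using he
    have hmem : ∀ F ∈ es.toFinset.powerset, e ∉ F := fun F hF h =>
      he' (Finset.mem_powerset.1 hF h)
    rw [List.toFinset_cons, Finset.sum_powerset_insert he', ← ih pair hes, List.flatMap_cons]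
    obtain ⟨i, j, hp⟩ : ∃ i j, pair e = (i, j) := ⟨_, _, rfl⟩
    have hends : (fun e => Sym2.mk (pair e).1 (pair e).2) e = s(i, j) := by simp [hp]
    rw [hp]
    by_cases hij : i = j
    · subst hij
      rw [forestCount_replicate_loop, Finset.sum_eq_zero, add_zero]
      intro F hF
      rw [if_neg (not_isForest_insert_loop (ends := fun e => Sym2.mk (pair e).1 (pair e).2) hends
        (hmem F hF))]
    · rw [forestCount_replicate hij, mergeList_flatMap_replicate,
        ih (fun e => Prod.map (merge i j) (merge i j) (pair e)) hes, Finset.mul_sum]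
      congr 1
      refine Finset.sum_congr rfl fun F hF => ?_
      rw [isForest_insert_iff (ends := fun e => Sym2.mk (pair e).1 (pair e).2) hij hends
        (hmem F hF), Finset.card_insert_of_notMem (hmem F hF),
        mul_ite, mul_zero, pow_succ']
      rfl

omit [DecidableEq V] in
open Classical in
theorem card_labeledForest [Fintype E] (ends : E → Sym2 V) (t : ℕ) :
    Nat.card (LabeledForest ends t) =
      ∑ F : Finset E, if IsForest ends F then t ^ F.card else 0 := by
  let S : Finset (Σ _ : Finset E, E → ℕ) :=
    (Finset.univ.filter fun F : Finset E => IsForest ends F).sigma fun F =>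
      Fintype.piFinset fun e => if e ∈ F then Finset.Icc 1 t else {0}
  have hS : Nat.card (LabeledForest ends t) = Nat.card S := by
    refine Nat.card_congr ((Equiv.sigmaEquivProd (Finset E) (E → ℕ)).symm.subtypeEquiv ?_)
    rintro ⟨F, l⟩
    simp only [S, Finset.mem_sigma, Finset.mem_filter, Finset.mem_univ, true_and,
      Fintype.mem_piFinset, Equiv.sigmaEquivProd_symm_apply]
    refine and_congr_right fun _ => ⟨fun h e => ?_, fun h => ⟨fun e he => ?_, fun e he => ?_⟩⟩
    · by_cases he : e ∈ F
      · simpa [he] using h.1 e he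
      · simpa [he] using h.2 e he
    · simpa [he] using h e
    · simpa [he] using h e
  rw [hS, Nat.card_eq_fintype_card, Fintype.card_coe, Finset.card_sigma, Finset.sum_filter]
  refine Finset.sum_congr rfl fun F _ => ?_
  congr 1
  rw [Fintype.card_piFinset]
  simp [apply_ite Finset.card]

end Counting

theorem crossNum_flatMap_replicate {n : ℕ} {E : Type} [Fintype E] (ends : E → Sym2 (Fin n))
    (t : ℕ) (pair : E → Fin n × Fin n) (hpair : ∀ e, ends e = s((pair e).1, (pair e).2))
    (I : Finset (Fin n)) :
    crossNum (Finset.univ.toList.flatMap fun e => List.replicate t (pair e)) I =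
      t * crossCount ends I := by
  classical
  have hset : {e : E | (∃ v ∈ ends e, v ∈ I) ∧ ∃ w ∈ ends e, w ∉ I} =
      (Finset.univ.filter fun e => ¬((pair e).1 ∈ I ↔ (pair e).2 ∈ I) : Finset E) := by
    ext e
    simp only [Set.mem_ofPred_eq, hpair, Sym2.mem_iff, Finset.coe_filter, Finset.mem_univ,
      true_and, exists_eq_or_imp, exists_eq_left]
    tauto
  rw [crossCount, hset, Set.ncard_coe_finset, Finset.card_filter, Finset.mul_sum, crossNum,
    List.countP_flatMap, ← Finset.sum_map_toList]
  congr 2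
  funext e
  simp only [Function.comp_apply, List.countP_replicate, decide_eq_true_eq, mul_ite, mul_one,
    mul_zero]

/-- For a finite multigraph `G`, an integer `t ≥ 1` and a
field `K` of characteristic `0`, the total dimension of `B_G^{F_t}` over `K`
equals the number of `t`-labeled forests of `G`. -/
theorem dim_B_Ft_eq_card_labeledForests {n : ℕ} {E : Type} [Fintype E]
    (ends : E → Sym2 (Fin n)) (t : ℕ) (ht : 1 ≤ t)
    (K : Type) [Field K] [CharZero K] :
    Module.finrank K (MvPolynomial (Fin n) K ⧸ forestIdeal K t ends)
      = Nat.card (LabeledForest ends t) := by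
  classical
  have hex : ∀ e, ∃ p : Fin n × Fin n, ends e = s(p.1, p.2) := fun e => by
    induction ends e with | _ a b => exact ⟨(a, b), rfl⟩
  choose pair hpair using hex
  have hideal : forestIdeal K t ends =
      cutIdeal K (Finset.univ.toList.flatMap fun e => List.replicate t (pair e)) := by
    refine le_antisymm (Ideal.span_mono ?_) (Ideal.span_le.2 ?_)
    · rintro _ ⟨I, -, rfl⟩
      exact ⟨I, by rw [crossNum_flatMap_replicate ends t pair hpair]⟩
    · rintro _ ⟨I, rfl⟩
      rcases I.eq_empty_or_nonempty with rfl | hI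
      · simp
      · rw [crossNum_flatMap_replicate ends t pair hpair]
        exact Ideal.subset_span ⟨I, hI, rfl⟩
  rw [hideal, finrank_quotient_cutIdeal,
    forestCount_flatMap_replicate t pair _ (Finset.nodup_toList _), card_labeledForest,
    Finset.toList_toFinset, Finset.powerset_univ, ← funext hpair]

end ForestAlg
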